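/- Log-majorization continuity lemma: Let x, y ∈ R_{≥0}^r be nonincreasing with x ≺_log y (Π_{i≤k} x_i ≤ Π_{i≤k} y_i for all k < r, with equality at k = r). Let y^{(i)} be a sequence of nonincreasing strictly positive vectors converging to y. Then there exist i_0 ∈ N and nonincreasing strictly positive vectors x^{(i)} for i ≥ i_0 with x^{(i)} → x and x^{(i)} ≺_log y^{(i)} for all i ≥ i_0. -/

import Mathlib

open scoped BigOperators

/-- Partial product of the first `k` entries of a vector indexed by `Fin r`. -/
def pProd {r : ℕ} (x : Fin r → ℝ) (k : ℕ) : ℝ :=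
  ∏ i ∈ Finset.univ.filter (fun i : Fin r => (i : ℕ) < k), x i

/-- Log-majorization `x ≺_log y` for vectors of length `r`: all partial products
of `x` are dominated by those of `y`, with equality for the full product. -/
def LogMaj {r : ℕ} (x y : Fin r → ℝ) : Prop :=
  (∀ k, pProd x k ≤ pProd y k) ∧ pProd x r = pProd y r

open Filter Topology

lemma pProd_zero {r : ℕ} (x : Fin r → ℝ) : pProd x 0 = 1 := by
  simp [pProd]

lemma pProd_succ {r : ℕ} (x : Fin r → ℝ) (k : Fin r) :
    pProd x (k + 1) = pProd x k * x k := by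
  have h : Finset.univ.filter (fun i : Fin r => (i : ℕ) < k + 1) =
      insert k (Finset.univ.filter (fun i : Fin r => (i : ℕ) < k)) := by
    ext i
    simp only [Finset.mem_filter, Finset.mem_univ, true_and, Finset.mem_insert, Fin.ext_iff]
    omega
  rw [pProd, pProd, h, Finset.prod_insert (by simp), mul_comm]

lemma pProd_of_le {r : ℕ} (x : Fin r → ℝ) {k : ℕ} (hk : r ≤ k) : pProd x k = ∏ i, x i := by
  rw [pProd, Finset.filter_true_of_mem fun i _ => i.isLt.trans_le hk]

lemma pProd_pos {r : ℕ} {x : Fin r → ℝ} (hx : ∀ i, 0 < x i) (k : ℕ) : 0 < pProd x k :=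
  Finset.prod_pos fun i _ => hx i

lemma tendsto_pProd {r : ℕ} {x : Fin r → ℝ} {xs : ℕ → Fin r → ℝ}
    (h : Tendsto xs atTop (𝓝 x)) (k : ℕ) :
    Tendsto (fun n => pProd (xs n) k) atTop (𝓝 (pProd x k)) :=
  tendsto_finsetProd _ fun i _ => tendsto_pi_nhds.1 h i

/-- The log-majorization meet of two vectors: its partial products are the minima of the partial
products of the two vectors. -/
noncomputable def logMeet {r : ℕ} (a b : Fin r → ℝ) (k : Fin r) : ℝ :=
  min (pProd a (k + 1)) (pProd b (k + 1)) / min (pProd a k) (pProd b k)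

section logMeet

variable {r : ℕ} {a b : Fin r → ℝ}

lemma logMeet_pos (ha : ∀ i, 0 < a i) (hb : ∀ i, 0 < b i) (k : Fin r) : 0 < logMeet a b k :=
  div_pos (lt_min (pProd_pos ha _) (pProd_pos hb _)) (lt_min (pProd_pos ha _) (pProd_pos hb _))

lemma pProd_logMeet (ha : ∀ i, 0 < a i) (hb : ∀ i, 0 < b i) {k : ℕ} (hk : k ≤ r) :
    pProd (logMeet a b) k = min (pProd a k) (pProd b k) := by
  induction k with
  | zero => simp [pProd_zero]
  | succ k ih =>
    rw [pProd_succ _ ⟨k, hk⟩, ih (by omega), logMeet]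
    exact mul_div_cancel₀ _ (lt_min (pProd_pos ha _) (pProd_pos hb _)).ne'

lemma antitone_logMeet (ha : ∀ i, 0 < a i) (hb : ∀ i, 0 < b i) (ha' : Antitone a)
    (hb' : Antitone b) : Antitone (logMeet a b) := by
  rcases r with _ | r
  · exact fun i => i.elim0
  refine Fin.antitone_iff_succ_le.2 fun i => ?_
  have hA := pProd_pos ha i
  have hB := pProd_pos hb i
  have hA1 := pProd_succ a i.castSucc
  have hB1 := pProd_succ b i.castSucc
  have hA2 := pProd_succ a i.succ
  have hB2 := pProd_succ b i.succ
  have hai := ha' (Fin.castSucc_lt_succ (i := i)).le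
  have hbi := hb' (Fin.castSucc_lt_succ (i := i)).le
  have ha1 := ha i.castSucc
  have hb1 := hb i.castSucc
  simp only [Fin.val_castSucc, Fin.val_succ] at hA1 hB1 hA2 hB2
  simp only [logMeet, Fin.val_castSucc, Fin.val_succ]
  rw [div_le_div_iff₀ (lt_min (pProd_pos ha _) (pProd_pos hb _)) (lt_min hA hB)]
  rw [hA2, hB2, hA1, hB1]
  have key : ∀ {P Q A u v : ℝ}, 0 < A → 0 < u → v ≤ u → 0 < Q → P ≤ A * u * v → Q ≤ A →
      P * Q ≤ A * u * (A * u) := by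
    intro P Q A u v hA hu hvu hQ hP hQA
    have hP' : P ≤ A * u * u := hP.trans (mul_le_mul_of_nonneg_left hvu (by positivity))
    calc P * Q ≤ A * u * u * A := mul_le_mul hP' hQA hQ.le (by positivity)
      _ = A * u * (A * u) := by ring
  rcases le_total (pProd a i * a i.castSucc) (pProd b i * b i.castSucc) with h | h
  · rw [min_eq_left h]
    exact key hA ha1 hai (lt_min hA hB) (min_le_left _ _) (min_le_left _ _)
  · rw [min_eq_right h]
    exact key hB hb1 hbi (lt_min hA hB) (min_le_right _ _) (min_le_right _ _)

lemma logMaj_logMeet (ha : ∀ i, 0 < a i) (hb : ∀ i, 0 < b i) (h : ∏ i, b i ≤ ∏ i, a i) :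
    LogMaj (logMeet a b) b := by
  have hr : pProd (logMeet a b) r = pProd b r := by
    rw [pProd_logMeet ha hb le_rfl, pProd_of_le a le_rfl, pProd_of_le b le_rfl, min_eq_right h]
  refine ⟨fun k => ?_, hr⟩
  rcases le_total k r with hk | hk
  · exact (pProd_logMeet ha hb hk).trans_le (min_le_right _ _)
  · rw [pProd_of_le _ hk, pProd_of_le _ hk, ← pProd_of_le _ le_rfl, hr, pProd_of_le _ le_rfl]

end logMeet

lemma tendsto_logMeet {r : ℕ} {x y : Fin r → ℝ} {as bs : ℕ → Fin r → ℝ} (hx : Antitone x)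
    (hx0 : ∀ i, 0 ≤ x i) (hxy : LogMaj x y)
    (ha : ∀ n i, 0 < as n i) (hb : ∀ n i, 0 < bs n i)
    (ha' : ∀ n, Antitone (as n)) (hb' : ∀ n, Antitone (bs n))
    (hax : Tendsto as atTop (𝓝 x)) (hby : Tendsto bs atTop (𝓝 y)) :
    Tendsto (fun n => logMeet (as n) (bs n)) atTop (𝓝 x) := by
  have hQ : ∀ k, Tendsto (fun n => min (pProd (as n) k) (pProd (bs n) k)) atTop
      (𝓝 (pProd x k)) := fun k => by
    simpa only [min_eq_left (hxy.1 k)] using (tendsto_pProd hax k).min (tendsto_pProd hby k)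
  refine tendsto_pi_nhds.2 fun k => ?_
  induction k using WellFoundedLT.induction with
  | ind k ih =>
    by_cases h0 : pProd x k = 0
    · obtain ⟨j, hj, hxj⟩ := Finset.prod_eq_zero_iff.1 h0
      have hjk : j < k := (Finset.mem_filter.1 hj).2
      have hxk : x k = 0 := le_antisymm (hxj ▸ hx hjk.le) (hx0 k)
      have hj0 := ih j hjk
      rw [hxj] at hj0
      rw [hxk]
      exact squeeze_zero (fun n => (logMeet_pos (ha n) (hb n) k).le)
        (fun n => antitone_logMeet (ha n) (hb n) (ha' n) (hb' n) hjk.le) hj0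
    · have h := (hQ (k + 1)).div (hQ k) h0
      rwa [pProd_succ, mul_div_cancel_left₀ _ h0] at h

lemma exists_tendsto_prod_le {r : ℕ} {x : Fin r → ℝ} (hx : Antitone x) (hx0 : ∀ i, 0 ≤ x i)
    {p : ℕ → ℝ} (hp : ∀ n, 0 < p n) (hp1 : r = 0 → ∀ n, p n = 1)
    (hpx : Tendsto p atTop (𝓝 (∏ i, x i))) :
    ∃ as : ℕ → Fin r → ℝ, (∀ n i, 0 < as n i) ∧ (∀ n, Antitone (as n)) ∧
      (∀ n, p n ≤ ∏ i, as n i) ∧ Tendsto as atTop (𝓝 x) := by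
  rcases Nat.eq_zero_or_pos r with rfl | hr
  · exact ⟨fun _ => x, fun _ i => i.elim0, fun _ => hx, fun n => by simp [hp1 rfl n],
      tendsto_const_nhds⟩
  rcases (Finset.prod_nonneg fun i _ => hx0 i : 0 ≤ ∏ i, x i).eq_or_lt with h0 | h0
  · rw [← h0] at hpx
    have hδ : Tendsto (fun n => p n ^ (r : ℝ)⁻¹) atTop (𝓝 0) := by
      have h := hpx.rpow_const (p := (r : ℝ)⁻¹) (Or.inr (by positivity))
      rwa [Real.zero_rpow (by positivity)] at h
    refine ⟨fun n i => max (x i) (p n ^ (r : ℝ)⁻¹),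
      fun n i => lt_max_of_lt_right (Real.rpow_pos_of_pos (hp n) _),
      fun n i j hij => max_le_max_right _ (hx hij), fun n => ?_, tendsto_pi_nhds.2 fun i => ?_⟩
    · calc p n = ∏ _i : Fin r, p n ^ (r : ℝ)⁻¹ := by
            rw [Finset.prod_const, Finset.card_univ, Fintype.card_fin,
              Real.rpow_inv_natCast_pow (hp n).le hr.ne']
        _ ≤ ∏ i, max (x i) (p n ^ (r : ℝ)⁻¹) :=
            Finset.prod_le_prod (fun _ _ => Real.rpow_nonneg (hp n).le _)
              fun _ _ => le_max_right _ _
    · simpa only [max_eq_left (hx0 i)] using (tendsto_const_nhds (x := x i)).max hδ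
  · have hxpos : ∀ i, 0 < x i := fun i =>
      (hx0 i).lt_of_ne' (Finset.prod_ne_zero_iff.1 h0.ne' i (Finset.mem_univ i))
    have hc1 : ∀ n, 1 ≤ max 1 (p n / ∏ i, x i) := fun n => le_max_left _ _
    have hc : Tendsto (fun n => max 1 (p n / ∏ i, x i)) atTop (𝓝 1) := by
      simpa only [div_self h0.ne', max_self] using
        (tendsto_const_nhds (x := (1 : ℝ))).max (hpx.div_const (∏ i, x i))
    refine ⟨fun n i => max 1 (p n / ∏ i, x i) * x i,
      fun n i => mul_pos (one_pos.trans_le (hc1 n)) (hxpos i),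
      fun n i j hij => mul_le_mul_of_nonneg_left (hx hij) (zero_le_one.trans (hc1 n)),
      fun n => ?_, tendsto_pi_nhds.2 fun i => ?_⟩
    · rw [Finset.prod_mul_distrib, Finset.prod_const, Finset.card_univ, Fintype.card_fin]
      rw [← div_le_iff₀ h0]
      exact (le_max_right _ _).trans (le_self_pow₀ (hc1 n) hr.ne')
    · simpa only [one_mul] using hc.mul_const (x i)

/-- log-majorization continuity lemma: if `x ≺_log y` for
nonincreasing nonnegative vectors, and `ys n` is a sequence of nonincreasing
strictly positive vectors converging to `y`, then there are `i₀` and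
nonincreasing strictly positive vectors `xs n` (for `n ≥ i₀`) converging to `x`
with `xs n ≺_log ys n` for all `n ≥ i₀`. -/
theorem logMaj_approx {r : ℕ} (x y : Fin r → ℝ)
    (hx : Antitone x) (hy : Antitone y)
    (hx0 : ∀ i, 0 ≤ x i) (hy0 : ∀ i, 0 ≤ y i)
    (hxy : LogMaj x y)
    (ys : ℕ → Fin r → ℝ) (hys : ∀ n, Antitone (ys n))
    (hyspos : ∀ n i, 0 < ys n i)
    (hconv : Filter.Tendsto ys Filter.atTop (nhds y)) :
    ∃ i0 : ℕ, ∃ xs : ℕ → Fin r → ℝ,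
      (∀ n ≥ i0, Antitone (xs n) ∧ (∀ i, 0 < xs n i) ∧ LogMaj (xs n) (ys n)) ∧
      Filter.Tendsto xs Filter.atTop (nhds x) := by
  obtain ⟨as, ha, ha', hle, hax⟩ := exists_tendsto_prod_le hx hx0 (p := fun n => ∏ i, ys n i)
    (fun n => Finset.prod_pos fun i _ => hyspos n i) (fun hr n => by subst hr; simp) (by
      have h := tendsto_pProd hconv r
      rw [← hxy.2] at h
      simpa only [pProd_of_le _ le_rfl] using h)
  exact ⟨0, fun n => logMeet (as n) (ys n),
    fun n _ => ⟨antitone_logMeet (ha n) (hyspos n) (ha' n) (hys n),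
      logMeet_pos (ha n) (hyspos n), logMaj_logMeet (ha n) (hyspos n) (hle n)⟩,
    tendsto_logMeet hx hx0 hxy ha hyspos ha' hys hax hconv⟩
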